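/- Let k ≥ 2. The braid T_k = δ₃^{3k+1} σ₄^{2k+2} σ₃ σ₄^{2k−1} ∈ B₅ satisfies: T_k is positive; Δ is not a prefix of T_k (i.e. ¬(Δ ≼ T_k)); T_k ≼ Δ^{4k−1}; and ¬(T_k ≼ Δ^{4k−2}). Consequently inf T_k = 0, sup T_k = 4k−1, and the canonical length of T_k is 4k−1. -/

import Mathlib

/-- Defining relations of the braid group on 5 strands, as elements of the
free group on four generators (generator `i` corresponds to `σ_{i+1}`). -/
def braidRels : Set (FreeGroup (Fin 4)) :=
  { r | (∃ i : Fin 3, r = FreeGroup.of i.castSucc * FreeGroup.of i.succ * FreeGroup.of i.castSucc *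
          (FreeGroup.of i.succ * FreeGroup.of i.castSucc * FreeGroup.of i.succ)⁻¹) ∨
        (∃ i j : Fin 4, 2 ≤ |(i : ℤ) - (j : ℤ)| ∧
          r = FreeGroup.of i * FreeGroup.of j * (FreeGroup.of j * FreeGroup.of i)⁻¹) }

/-- The Artin braid group on 5 strands. -/
abbrev B5 : Type := PresentedGroup braidRels

/-- The Artin generators (index `i` corresponds to `σ_{i+1}`). -/
def gen (i : Fin 4) : B5 := PresentedGroup.of i

def s1 : B5 := gen 0
def s2 : B5 := gen 1
def s3 : B5 := gen 2
def s4 : B5 := gen 3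

/-- A braid is positive if it lies in the submonoid generated by `σ₁,…,σ₄`. -/
def IsPos (x : B5) : Prop := x ∈ Submonoid.closure (Set.range gen)

/-- Prefix order: `Pre x y` means `x ≼ y`, i.e. `x⁻¹ y` is positive. -/
def Pre (x y : B5) : Prop := IsPos (x⁻¹ * y)

/-- The half twist `Δ = σ₁σ₂σ₃σ₄σ₁σ₂σ₃σ₁σ₂σ₁`. -/
def Δ : B5 := s1*s2*s3*s4*s1*s2*s3*s1*s2*s1

def δ3 : B5 := s2*s1
def Δ3 : B5 := s2*s1*s2
def δt3 : B5 := s1*s2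

/-- A braid `s` is simple if `1 ≼ s ≼ Δ`. -/
def IsSimple (s : B5) : Prop := IsPos s ∧ Pre s Δ

/-- Two simple braids `s, t` are left-weighted if no generator `σᵢ` is such that
`s σᵢ` and `σᵢ⁻¹ t` are both simple. -/
def LeftWeighted (s t : B5) : Prop :=
  ¬ ∃ i : Fin 4, IsSimple (s * gen i) ∧ IsSimple ((gen i)⁻¹ * t)

/-- The canonical length of `z`: the minimum of `q - p` over `p ≤ q` with
`Δ^p ≼ z` and `z ≼ Δ^q`. -/
noncomputable def canLen (z : B5) : ℕ :=
  sInf { n : ℕ | ∃ p q : ℤ, p ≤ q ∧ q - p = (n : ℤ) ∧ Pre (Δ ^ p) z ∧ Pre z (Δ ^ q) }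

/-- `y` belongs to the super summit set of `x`:
`y` is conjugate to `x` and has minimal canonical length among conjugates of `x`. -/
def InSSS (x y : B5) : Prop :=
  IsConj x y ∧ ∀ z : B5, IsConj x z → canLen y ≤ canLen z

/-- The braid `T_k = δ₃^{3k+1} σ₄^{2k+2} σ₃ σ₄^{2k-1}`. -/
def T (k : ℕ) : B5 := δ3 ^ (3*k+1) * s4 ^ (2*k+2) * s3 * s4 ^ (2*k-1)

/-- The braid `T'_k`, a rigid conjugate of `T_k`. -/
def T' (k : ℕ) : B5 :=
  (s1*s3)^(2*k-2) * (s3*s4*Δ3) * (Δ3*s4) * ((δ3*s4)*(δt3*s4))^(k-1) * (δ3*s4*s3*s4)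

/-! ### Words in the generators -/

/-- The braid represented by a positive word. -/
def evalWord (w : List (Fin 4)) : B5 := (w.map gen).prod

/-- Apply a commutation or a braid relation at position `n` of a word, if one applies there. -/
def braidMove : ℕ → List (Fin 4) → List (Fin 4)
  | 0, i :: j :: [] => if 2 ≤ |(i : ℤ) - j| then [j, i] else [i, j]
  | 0, i :: j :: l :: w =>
      if 2 ≤ |(i : ℤ) - j| then j :: i :: l :: w
      else if i = l ∧ |(i : ℤ) - j| = 1 then j :: i :: j :: w
      else i :: j :: l :: w
  | n + 1, i :: w => i :: braidMove n w
  | _, w => w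

theorem gen_mul_comm {i j : Fin 4} (h : 2 ≤ |(i : ℤ) - j|) : gen i * gen j = gen j * gen i :=
  mul_inv_eq_one.1 <| PresentedGroup.one_of_mem (rels := braidRels) (Or.inr ⟨i, j, h, rfl⟩)

theorem gen_braid_succ (i : Fin 3) :
    gen i.castSucc * gen i.succ * gen i.castSucc = gen i.succ * gen i.castSucc * gen i.succ :=
  mul_inv_eq_one.1 <| PresentedGroup.one_of_mem (rels := braidRels) (Or.inl ⟨i, rfl⟩)

theorem gen_braid {i j : Fin 4} (h : |(i : ℤ) - j| = 1) :
    gen i * gen j * gen i = gen j * gen i * gen j := by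
  have key : ∀ i j : Fin 4, |(i : ℤ) - j| = 1 →
      ∃ l : Fin 3, (i = l.castSucc ∧ j = l.succ) ∨ (j = l.castSucc ∧ i = l.succ) := by decide
  obtain ⟨l, ⟨rfl, rfl⟩ | ⟨rfl, rfl⟩⟩ := key i j h
  · exact gen_braid_succ l
  · exact (gen_braid_succ l).symm

theorem evalWord_cons (i : Fin 4) (w : List (Fin 4)) :
    evalWord (i :: w) = gen i * evalWord w := by
  simp [evalWord]

theorem evalWord_braidMove (n : ℕ) (w : List (Fin 4)) :
    evalWord (braidMove n w) = evalWord w := by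
  fun_induction braidMove n w with
  | case1 i j h => simp [evalWord, gen_mul_comm h]
  | case3 i j l w h => simp only [evalWord_cons, ← mul_assoc, gen_mul_comm h]
  | case4 i j l w h h' =>
    obtain ⟨rfl, h'⟩ := h'
    simp only [evalWord_cons, ← mul_assoc, gen_braid h']
  | case6 n i w ih => rw [evalWord_cons, evalWord_cons, ih]
  | _ => rfl

theorem evalWord_foldl_braidMove (ns : List ℕ) (w : List (Fin 4)) :
    evalWord (ns.foldl (fun w n => braidMove n w) w) = evalWord w := by
  induction ns generalizing w with
  | nil => rfl
  | cons n ns ih => rw [List.foldl_cons, ih, evalWord_braidMove]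

/-- Two words represent the same braid if a sequence of moves transforms one into the other. -/
theorem evalWord_eq_of_moves (ns : List ℕ) {w w' : List (Fin 4)}
    (h : ns.foldl (fun w n => braidMove n w) w = w') : evalWord w = evalWord w' := by
  rw [← h, evalWord_foldl_braidMove]

/-! ### Positive braids and the prefix order -/

theorem IsPos.one : IsPos 1 := Submonoid.one_mem _

theorem IsPos.gen (i : Fin 4) : IsPos (gen i) := Submonoid.subset_closure ⟨i, rfl⟩

theorem IsPos.mul {x y : B5} (hx : IsPos x) (hy : IsPos y) : IsPos (x * y) :=
  Submonoid.mul_mem _ hx hy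

theorem IsPos.pow {x : B5} (hx : IsPos x) (n : ℕ) : IsPos (x ^ n) := Submonoid.pow_mem _ hx n

theorem IsPos.evalWord (w : List (Fin 4)) : IsPos (evalWord w) := by
  induction w with
  | nil => exact .one
  | cons i w ih => rw [evalWord_cons]; exact (IsPos.gen i).mul ih

theorem Pre.trans {x y z : B5} (hxy : Pre x y) (hyz : Pre y z) : Pre x z := by
  have h := IsPos.mul hxy hyz
  rwa [mul_assoc, mul_inv_cancel_left] at h

theorem Pre.pow_of_isPos {x : B5} (hx : IsPos x) {m n : ℤ} (h : m ≤ n) :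
    Pre (x ^ m) (x ^ n) := by
  obtain ⟨d, rfl⟩ := Int.le.dest h
  rw [Pre, zpow_add, inv_mul_cancel_left, zpow_natCast]
  exact hx.pow d

theorem Δ_eq_evalWord : Δ = evalWord [0, 1, 2, 3, 0, 1, 2, 0, 1, 0] := by
  simp [Δ, s1, s2, s3, s4, evalWord, mul_assoc]

theorem isPos_Δ : IsPos Δ := Δ_eq_evalWord ▸ .evalWord _

theorem Δ_mul_gen (i : Fin 4) : Δ * gen i = gen i.rev * Δ := by
  have hl : Δ * gen i = evalWord ([0, 1, 2, 3, 0, 1, 2, 0, 1, 0] ++ [i]) := by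
    simp [Δ_eq_evalWord, evalWord, mul_assoc]
  have hr : gen i.rev * Δ = evalWord (i.rev :: [0, 1, 2, 3, 0, 1, 2, 0, 1, 0]) := by
    rw [evalWord_cons, Δ_eq_evalWord]
  rw [hl, hr]
  fin_cases i
  · exact evalWord_eq_of_moves [7, 5, 4, 2, 1, 0] (by decide)
  · exact evalWord_eq_of_moves [6, 4, 3, 1, 0, 8] (by decide)
  · exact evalWord_eq_of_moves [3, 2, 0, 6, 9, 7, 5, 7] (by decide)
  · exact evalWord_eq_of_moves [3, 2, 4, 9, 8, 7, 5, 3, 1, 3, 5, 4] (by decide)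

theorem IsPos.conj_Δ {x : B5} (hx : IsPos x) : IsPos (Δ⁻¹ * x * Δ) := by
  induction hx using Submonoid.closure_induction with
  | mem x hx =>
    obtain ⟨i, rfl⟩ := hx
    have h := Δ_mul_gen i.rev
    rw [Fin.rev_rev] at h
    rw [mul_assoc, ← h, inv_mul_cancel_left]
    exact .gen _
  | one => simpa using IsPos.one
  | mul x y _ _ hx hy =>
    have h := hx.mul hy
    simpa [mul_assoc] using h

theorem IsPos.conj_Δ_pow {x : B5} (hx : IsPos x) (n : ℕ) : IsPos ((Δ ^ n)⁻¹ * x * Δ ^ n) := by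
  induction n with
  | zero => simpa using hx
  | succ n ih =>
    have h := ih.conj_Δ
    simpa [pow_succ, mul_assoc] using h

theorem Pre.mul_Δ_pow {x y : B5} {m n : ℕ} (hx : Pre x (Δ ^ m)) (hy : Pre y (Δ ^ n)) :
    Pre (x * y) (Δ ^ (m + n)) := by
  have h := IsPos.mul hy (IsPos.conj_Δ_pow hx n)
  rw [Pre, pow_add]
  convert h using 1
  group

theorem Pre.pow_Δ {x : B5} (hx : Pre x Δ) (n : ℕ) : Pre (x ^ n) (Δ ^ n) := by
  induction n with
  | zero => simpa [Pre] using IsPos.one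
  | succ n ih =>
    rw [pow_succ]
    exact ih.mul_Δ_pow (n := 1) (by simpa using hx)

theorem pre_Δ_of_moves (ns : List ℕ) {u v : List (Fin 4)}
    (h : ns.foldl (fun w n => braidMove n w) [0, 1, 2, 3, 0, 1, 2, 0, 1, 0] = u ++ v) :
    Pre (evalWord u) Δ := by
  have : evalWord (u ++ v) = evalWord u * evalWord v := by simp [evalWord]
  rw [Pre, Δ_eq_evalWord, evalWord_eq_of_moves ns h, this, inv_mul_cancel_left]
  exact .evalWord v

/-! ### Factorization of `T k` into simple braids -/

theorem δ3_pow_three : δ3 ^ 3 = Δ3 ^ 2 := by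
  have h : evalWord [1, 0, 1, 0, 1, 0] = evalWord [1, 0, 1, 1, 0, 1] :=
    evalWord_eq_of_moves [3] (by decide)
  simpa [evalWord, δ3, Δ3, s1, s2, pow_succ, mul_assoc] using h

theorem commute_s1_s4 : Commute s1 s4 := gen_mul_comm (by decide)

theorem commute_s2_s4 : Commute s2 s4 := gen_mul_comm (by decide)

theorem T_eq_simple_prod (m : ℕ) :
    T (m + 2) = (Δ3 * s4) ^ (2 * m + 4) * (δ3 * s4 * s3 * s4) * (s3 * s4) * s4 ^ (2 * m + 1) := by
  have hδ : Commute δ3 s4 := commute_s2_s4.mul_left commute_s1_s4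
  have hΔ : Commute Δ3 s4 := hδ.mul_left commute_s2_s4
  have hbr : s4 * s4 * s3 * s4 * s4 = s4 * s3 * s4 * s3 * s4 := by
    have h : evalWord [3, 3, 2, 3, 3] = evalWord [3, 2, 3, 2, 3] :=
      evalWord_eq_of_moves [1] (by decide)
    simpa [evalWord, s3, s4, mul_assoc] using h
  have hpow : δ3 ^ (3 * (m + 2) + 1) = Δ3 ^ (2 * m + 4) * δ3 := by
    rw [pow_succ, pow_mul, δ3_pow_three, ← pow_mul]
    ring_nf
  calc T (m + 2)
      = Δ3 ^ (2 * m + 4) * (δ3 * s4 ^ (2 * m + 4)) * (s4 * s4 * s3 * s4 * s4)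
          * s4 ^ (2 * m + 1) := by
        rw [T, hpow, show 2 * (m + 2) + 2 = 2 * m + 4 + 2 by ring,
          show 2 * (m + 2) - 1 = 2 + (2 * m + 1) by omega, pow_add s4 (2 * m + 4) 2,
          pow_add s4 2, pow_two]
        simp only [mul_assoc]
    _ = _ := by
        rw [(hδ.pow_right _).eq, hbr, hΔ.mul_pow]
        simp only [mul_assoc]

theorem pre_T_Δ_pow {k : ℕ} (hk : 2 ≤ k) : Pre (T k) (Δ ^ (4 * k - 1)) := by
  obtain ⟨m, rfl⟩ := Nat.exists_eq_add_of_le' hk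
  have h₁ : Pre (Δ3 * s4) Δ := by
    have h := pre_Δ_of_moves [3, 2, 0, 7, 5, 3] (u := [1, 0, 1, 3]) (v := [2, 3, 1, 2, 0, 1])
      (by decide)
    simpa [evalWord, Δ3, s1, s2, s4, mul_assoc] using h
  have h₂ : Pre (δ3 * s4 * s3 * s4) Δ := by
    have h := pre_Δ_of_moves [3, 2, 0, 4, 2, 4, 3, 7, 6, 4, 2]
      (u := [1, 0, 3, 2, 3]) (v := [1, 2, 3, 0, 1]) (by decide)
    simpa [evalWord, δ3, s1, s2, s3, s4, mul_assoc] using h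
  have h₃ : Pre (s3 * s4) Δ := by
    have h := pre_Δ_of_moves [6, 4, 3, 1, 0, 6, 5, 3, 2, 1]
      (u := [2, 3]) (v := [0, 1, 2, 3, 0, 1, 2, 0]) (by decide)
    simpa [evalWord, s3, s4] using h
  have h₄ : Pre s4 Δ := by
    have h := pre_Δ_of_moves [7, 5, 4, 2, 1, 0]
      (u := [3]) (v := [0, 1, 2, 3, 0, 1, 2, 0, 1]) (by decide)
    simpa [evalWord, s4] using h
  have h := (((h₁.pow_Δ (2 * m + 4)).mul_Δ_pow (h₂.pow_Δ 1)).mul_Δ_pow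
    (h₃.pow_Δ 1)).mul_Δ_pow (h₄.pow_Δ (2 * m + 1))
  rw [T_eq_simple_prod]
  convert h using 2
  · simp
  · omega

theorem isPos_T (k : ℕ) : IsPos (T k) :=
  ((((((IsPos.gen 1).mul (.gen 0)).pow _).mul ((IsPos.gen 3).pow _)).mul (.gen 2)).mul
    ((IsPos.gen 3).pow _))

/-! ### The Lawrence–Krammer representation at `q = -1`, `t = 3` -/

open Matrix in
/-- The matrices of the Lawrence–Krammer representation specialized at `q = -1`, `t = 3`, in the
basis indexed by the pairs of strands in lexicographic order. -/
def lkMatrix : Fin 4 → Matrix (Fin 10) (Fin 10) ℤ :=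
  ![
    !![3, 6, 6, 6, 0, 0, 0, 0, 0, 0;
       0, 0, 0, 0, 1, 0, 0, 0, 0, 0;
       0, 0, 0, 0, 0, 1, 0, 0, 0, 0;
       0, 0, 0, 0, 0, 0, 1, 0, 0, 0;
       0, -1, 0, 0, 2, 0, 0, 0, 0, 0;
       0, 0, -1, 0, 0, 2, 0, 0, 0, 0;
       0, 0, 0, -1, 0, 0, 2, 0, 0, 0;
       0, 0, 0, 0, 0, 0, 0, 1, 0, 0;
       0, 0, 0, 0, 0, 0, 0, 0, 1, 0;
       0, 0, 0, 0, 0, 0, 0, 0, 0, 1],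
    !![2, 1, 0, 0, 0, 0, 0, 0, 0, 0;
       -1, 0, 0, 0, 0, 0, 0, 0, 0, 0;
       0, 0, 1, 0, 0, 0, 0, 0, 0, 0;
       0, 0, 0, 1, 0, 0, 0, 0, 0, 0;
       0, -6, -12, -12, 3, 6, 6, 0, 0, 0;
       0, 0, 0, 0, 0, 0, 0, 1, 0, 0;
       0, 0, 0, 0, 0, 0, 0, 0, 1, 0;
       0, 0, 0, 0, 0, -1, 0, 2, 0, 0;
       0, 0, 0, 0, 0, 0, -1, 0, 2, 0;
       0, 0, 0, 0, 0, 0, 0, 0, 0, 1],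
    !![1, 0, 0, 0, 0, 0, 0, 0, 0, 0;
       0, 2, 1, 0, 0, 0, 0, 0, 0, 0;
       0, -1, 0, 0, 0, 0, 0, 0, 0, 0;
       0, 0, 0, 1, 0, 0, 0, 0, 0, 0;
       0, 0, 0, 0, 2, 1, 0, 0, 0, 0;
       0, 0, 0, 0, -1, 0, 0, 0, 0, 0;
       0, 0, 0, 0, 0, 0, 1, 0, 0, 0;
       0, 0, 6, 12, 0, -6, -12, 3, 6, 0;
       0, 0, 0, 0, 0, 0, 0, 0, 0, 1;
       0, 0, 0, 0, 0, 0, 0, 0, -1, 2],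
    !![1, 0, 0, 0, 0, 0, 0, 0, 0, 0;
       0, 1, 0, 0, 0, 0, 0, 0, 0, 0;
       0, 0, 2, 1, 0, 0, 0, 0, 0, 0;
       0, 0, -1, 0, 0, 0, 0, 0, 0, 0;
       0, 0, 0, 0, 1, 0, 0, 0, 0, 0;
       0, 0, 0, 0, 0, 2, 1, 0, 0, 0;
       0, 0, 0, 0, 0, -1, 0, 0, 0, 0;
       0, 0, 0, 0, 0, 0, 0, 2, 1, 0;
       0, 0, 0, 0, 0, 0, 0, -1, 0, 0;
       0, 0, 0, -6, 0, 0, 6, 0, -6, 3]]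

/-- The half twist in the specialized Lawrence–Krammer representation, divided by `t = 3`. -/
def lkHalfTwist : Matrix (Fin 10) (Fin 10) ℤ :=
  !![0, 0, 0, 0, 0, 0, 0, 0, 0, 1;
     0, 0, 0, 0, 0, 0, 0, 0, -1, 0;
     0, 0, 0, 0, 0, 0, 1, 0, 0, 0;
     0, 0, 0, -1, 0, 0, 0, 0, 0, 0;
     0, 0, 0, 0, 0, 0, 0, 1, 0, 0;
     0, 0, 0, 0, 0, -1, 0, 0, 0, 0;
     0, 0, 1, 0, 0, 0, 0, 0, 0, 0;
     0, 0, 0, 0, 1, 0, 0, 0, 0, 0;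
     0, -1, 0, 0, 0, 0, 0, 0, 0, 0;
     1, 0, 0, 0, 0, 0, 0, 0, 0, 0]

theorem lkMatrix_braid (i : Fin 3) :
    lkMatrix i.castSucc * lkMatrix i.succ * lkMatrix i.castSucc =
      lkMatrix i.succ * lkMatrix i.castSucc * lkMatrix i.succ := by
  decide +kernel +revert

theorem lkMatrix_comm (i j : Fin 4) (h : 2 ≤ |(i : ℤ) - j|) :
    lkMatrix i * lkMatrix j = lkMatrix j * lkMatrix i := by
  decide +kernel +revert

theorem lkMatrix_cubic (i : Fin 4) :
    lkMatrix i * (lkMatrix i * lkMatrix i - 5 * lkMatrix i + 7) = 3 := by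
  have h : ∀ i, lkMatrix i * (lkMatrix i * lkMatrix i - Matrix.diagonal (fun _ => 5) * lkMatrix i
      + Matrix.diagonal (fun _ => 7)) = Matrix.diagonal (fun _ => 3) := by decide +kernel
  exact h i

theorem lkMatrix_Δ :
    lkMatrix 0 * lkMatrix 1 * lkMatrix 2 * lkMatrix 3 * lkMatrix 0 * lkMatrix 1 * lkMatrix 2 *
      lkMatrix 0 * lkMatrix 1 * lkMatrix 0 = (3 : ℤ) • lkHalfTwist := by
  have h₄ : lkMatrix 0 * lkMatrix 1 * lkMatrix 2 =
      !![0, 0, 3, 6, 0, 0, 0, 0, 0, 0;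
         0, 0, -6, -12, 0, 3, 6, 0, 0, 0;
         0, 0, 6, 12, 0, -6, -12, 3, 6, 0;
         0, 0, 0, 0, 0, 0, 0, 0, 0, 1;
         1, 0, -12, -24, 0, 6, 12, 0, 0, 0;
         0, 1, 12, 24, 0, -12, -24, 6, 12, 0;
         0, 0, 0, -1, 0, 0, 0, 0, 0, 2;
         0, 0, 12, 24, 1, -12, -24, 6, 12, 0;
         0, 0, 0, 0, 0, 0, -1, 0, 0, 2;
         0, 0, 0, 0, 0, 0, 0, 0, -1, 2] := by
    decide +kernel
  have h₅ : lkMatrix 0 * lkMatrix 1 * lkMatrix 2 * lkMatrix 3 =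
      !![0, 0, 0, 3, 0, 0, 0, 0, 0, 0;
         0, 0, 0, -6, 0, 0, 3, 0, 0, 0;
         0, 0, 0, 6, 0, 0, -6, 0, 3, 0;
         0, 0, 0, -6, 0, 0, 6, 0, -6, 3;
         1, 0, 0, -12, 0, 0, 6, 0, 0, 0;
         0, 1, 0, 12, 0, 0, -12, 0, 6, 0;
         0, 0, 1, -12, 0, 0, 12, 0, -12, 6;
         0, 0, 0, 12, 1, 0, -12, 0, 6, 0;
         0, 0, 0, -12, 0, 1, 12, 0, -12, 6;
         0, 0, 0, -12, 0, 0, 12, 1, -12, 6] := by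
    rw [h₄]
    decide +kernel
  have h₃ : lkMatrix 0 * lkMatrix 1 * lkMatrix 0 =
      !![0, 0, 0, 0, 3, 6, 6, 0, 0, 0;
         0, -3, -6, -6, 0, 0, 0, 0, 0, 0;
         0, 0, 0, 0, 0, 0, 0, 1, 0, 0;
         0, 0, 0, 0, 0, 0, 0, 0, 1, 0;
         3, 0, -6, -6, 0, 0, 0, 0, 0, 0;
         0, 0, 0, 0, 0, -1, 0, 2, 0, 0;
         0, 0, 0, 0, 0, 0, -1, 0, 2, 0;
         0, 0, 1, 0, 0, -2, 0, 2, 0, 0;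
         0, 0, 0, 1, 0, 0, -2, 0, 2, 0;
         0, 0, 0, 0, 0, 0, 0, 0, 0, 1] := by
    decide +kernel
  calc _ = lkMatrix 0 * lkMatrix 1 * lkMatrix 2 * lkMatrix 3 *
        (lkMatrix 0 * lkMatrix 1 * lkMatrix 2) * (lkMatrix 0 * lkMatrix 1 * lkMatrix 0) := by
        simp only [mul_assoc]
    _ = _ := by
        rw [h₅, h₄, h₃]
        decide +kernel

theorem lkHalfTwist_mul_self : lkHalfTwist * lkHalfTwist = 1 := by decide +kernel

theorem lkMatrix_cubic_comm (i : Fin 4) :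
    lkMatrix i * (lkMatrix i * lkMatrix i - 5 * lkMatrix i + 7) =
      (lkMatrix i * lkMatrix i - 5 * lkMatrix i + 7) * lkMatrix i := by
  noncomm_ring

/-- Extension of scalars from integral to rational matrices. -/
abbrev castMatrix : Matrix (Fin 10) (Fin 10) ℤ →+* Matrix (Fin 10) (Fin 10) ℚ :=
  (Int.castRingHom ℚ).mapMatrix

theorem castMatrix_injective : Function.Injective castMatrix :=
  Matrix.map_injective Int.cast_injective

/-- The image of a generator in the specialized Lawrence–Krammer representation. -/
def lkUnit (i : Fin 4) : (Matrix (Fin 10) (Fin 10) ℚ)ˣ where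
  val := castMatrix (lkMatrix i)
  inv := (3⁻¹ : ℚ) • castMatrix (lkMatrix i * lkMatrix i - 5 * lkMatrix i + 7)
  val_inv := by
    rw [mul_smul_comm, ← map_mul, lkMatrix_cubic]
    rw [map_ofNat]
    ext a b
    simp [Matrix.ofNat_apply, Matrix.one_apply]
  inv_val := by
    rw [smul_mul_assoc, ← map_mul, ← lkMatrix_cubic_comm, lkMatrix_cubic, map_ofNat]
    ext a b
    simp [Matrix.ofNat_apply, Matrix.one_apply]

/-- The Lawrence–Krammer representation specialized at `q = -1`, `t = 3`. -/
def lkHom : B5 →* (Matrix (Fin 10) (Fin 10) ℚ)ˣ :=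
  PresentedGroup.toGroup (f := lkUnit) <| by
    rintro r (⟨i, rfl⟩ | ⟨i, j, h, rfl⟩)
    · simp only [map_mul, map_inv, FreeGroup.lift_apply_of, mul_inv_eq_one]
      ext1
      simp only [Units.val_mul, lkUnit, ← map_mul, lkMatrix_braid]
    · simp only [map_mul, map_inv, FreeGroup.lift_apply_of, mul_inv_eq_one]
      ext1
      simp only [Units.val_mul, lkUnit, ← map_mul, lkMatrix_comm i j h]

theorem coe_lkHom_gen (i : Fin 4) : (lkHom (gen i) : Matrix _ _ ℚ) = castMatrix (lkMatrix i) := by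
  rw [lkHom, gen, PresentedGroup.toGroup.of]
  rfl

/-- Positive braids act by integral matrices. -/
theorem IsPos.exists_lkHom_eq {x : B5} (hx : IsPos x) :
    ∃ N, (lkHom x : Matrix _ _ ℚ) = castMatrix N := by
  induction hx using Submonoid.closure_induction with
  | mem x hx =>
    obtain ⟨i, rfl⟩ := hx
    exact ⟨_, coe_lkHom_gen i⟩
  | one => exact ⟨1, by simp⟩
  | mul x y _ _ hx hy =>
    obtain ⟨M, hM⟩ := hx
    obtain ⟨N, hN⟩ := hy
    exact ⟨M * N, by rw [map_mul, Units.val_mul, hM, hN, map_mul]⟩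

theorem coe_lkHom_Δ : (lkHom Δ : Matrix _ _ ℚ) = castMatrix ((3 : ℤ) • lkHalfTwist) := by
  simp only [Δ, s1, s2, s3, s4, map_mul, Units.val_mul, coe_lkHom_gen, ← lkMatrix_Δ]

open Matrix

theorem pow_mulVec_of_eq_smul {M : Matrix (Fin 10) (Fin 10) ℤ} {v : Fin 10 → ℤ} {c : ℤ}
    (h : M *ᵥ v = c • v) (n : ℕ) : M ^ n *ᵥ v = c ^ n • v := by
  induction n with
  | zero => simp
  | succ n ih => rw [pow_succ, ← mulVec_mulVec, h, mulVec_smul, ih, smul_smul, pow_succ']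

theorem vecMul_pow_of_eq_smul {M : Matrix (Fin 10) (Fin 10) ℤ} {v : Fin 10 → ℤ} {c : ℤ}
    (h : v ᵥ* M = c • v) (n : ℕ) : v ᵥ* M ^ n = c ^ n • v := by
  induction n with
  | zero => simp
  | succ n ih => rw [pow_succ', ← vecMul_vecMul, h, smul_vecMul, ih, smul_smul, pow_succ']

theorem not_pre_Δ_T (k : ℕ) : ¬ Pre Δ (T k) := by
  intro h
  obtain ⟨N, hN⟩ := IsPos.exists_lkHom_eq h
  have hT : (lkMatrix 1 * lkMatrix 0) ^ (3 * k + 1) * lkMatrix 3 ^ (2 * k + 2) * lkMatrix 2 *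
      lkMatrix 3 ^ (2 * k - 1) = (3 : ℤ) • lkHalfTwist * N := by
    apply castMatrix_injective
    rw [map_mul _ _ N, ← hN, ← coe_lkHom_Δ, ← Units.val_mul, ← map_mul, mul_inv_cancel_left]
    simp only [T, δ3, s1, s2, s3, s4, map_mul, map_pow, Units.val_mul, Units.val_pow_eq_pow_val,
      coe_lkHom_gen]
  let g : Fin 10 → ℤ := ![0, 0, 1, 1, 0, -1, -1, 1, 1, 0]
  let v : Fin 10 → ℤ := ![0, 1, 0, 0, 0, 0, 0, 0, 0, 0]
  have h₁ : g ᵥ* (lkMatrix 1 * lkMatrix 0) = (1 : ℤ) • g := by decide +kernel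
  have h₂ : g ᵥ* lkMatrix 3 = (1 : ℤ) • g := by decide +kernel
  have h₃ : lkMatrix 3 *ᵥ v = (1 : ℤ) • v := by decide +kernel
  have h₄ : g ᵥ* lkMatrix 2 ⬝ᵥ v = -1 := by decide +kernel
  have e := congrArg (fun M => g ᵥ* M ⬝ᵥ v) hT
  simp only [← vecMul_vecMul, vecMul_pow_of_eq_smul h₁, vecMul_pow_of_eq_smul h₂, one_pow,
    one_smul, vecMul_smul, smul_vecMul, smul_dotProduct] at e
  rw [← dotProduct_mulVec, pow_mulVec_of_eq_smul h₃, one_pow, one_smul, h₄, smul_eq_mul] at e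
  omega

theorem lkHom_Δ_pow_two_mul (n : ℕ) :
    (lkHom (Δ ^ (2 * n)) : Matrix _ _ ℚ) = castMatrix (9 ^ n) := by
  have h : ((3 : ℤ) • lkHalfTwist) ^ 2 = 9 := by
    rw [smul_pow, pow_two lkHalfTwist, lkHalfTwist_mul_self]
    ext a b
    simp [Matrix.ofNat_apply, Matrix.one_apply]
  rw [map_pow, Units.val_pow_eq_pow_val, coe_lkHom_Δ, ← map_pow, pow_mul, h]

theorem not_pre_T_Δ_pow {k : ℕ} (hk : 2 ≤ k) : ¬ Pre (T k) (Δ ^ (4 * k - 2)) := by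
  intro h
  set D := Δ ^ (4 * k - 2) with hD
  have hDR : (lkHom D : Matrix _ _ ℚ) = castMatrix (9 ^ (2 * k - 1)) := by
    rw [hD, ← lkHom_Δ_pow_two_mul]; congr 3; omega
  obtain ⟨Q, hQ⟩ := IsPos.exists_lkHom_eq
    (IsPos.mul h (((IsPos.gen 1).mul (.gen 0)).pow (3 * k + 1)))
  have hconj : lkMatrix 3 ^ (2 * k - 1) * Q * lkMatrix 3 ^ (2 * k + 2) * lkMatrix 2 =
      9 ^ (2 * k - 1) := by
    apply castMatrix_injective
    set c := (gen 1 * gen 0) ^ (3 * k + 1) * gen 3 ^ (2 * k + 2) * gen 2 with hc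
    have hcomm : lkHom (c⁻¹ * D * c) = lkHom D := by
      rw [map_mul, map_mul, map_inv, mul_assoc, inv_mul_eq_iff_eq_mul]
      ext1
      rw [Units.val_mul, Units.val_mul, hDR, map_pow, map_ofNat]
      exact ((Nat.cast_commute 9 _).pow_left _).eq
    rw [← hDR, ← hcomm]
    have : c⁻¹ * D * c = gen 3 ^ (2 * k - 1) * ((T k)⁻¹ * D * (gen 1 * gen 0) ^ (3 * k + 1)) *
        gen 3 ^ (2 * k + 2) * gen 2 := by
      simp [hc, T, δ3, s1, s2, s3, s4, mul_assoc]
    rw [this]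
    simp only [map_mul, map_pow, Units.val_mul, Units.val_pow_eq_pow_val, coe_lkHom_gen] at hQ ⊢
    rw [← hQ]
  let f : Fin 10 → ℤ := ![0, 0, 3, -3, 0, -3, 3, 3, -3, 2]
  let e : Fin 10 → ℤ := ![0, 0, 0, 0, 0, 0, 0, 0, 0, 1]
  let y : Fin 10 → ℤ := ![0, 0, 0, 0, 0, 0, 0, 6, -3, 0]
  have h₁ : f ᵥ* lkMatrix 3 = (3 : ℤ) • f := by decide +kernel
  have h₂ : lkMatrix 3 *ᵥ e = (3 : ℤ) • e := by decide +kernel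
  have h₃ : lkMatrix 2 *ᵥ y = (3 : ℤ) • e := by decide +kernel
  have h₄ : f ⬝ᵥ y = 27 := by decide +kernel
  have h₅ : (9 : Matrix (Fin 10) (Fin 10) ℤ) *ᵥ y = (9 : ℤ) • y := by
    rw [ofNat_mulVec]
  have key := congrArg (fun M => f ⬝ᵥ M *ᵥ y) hconj
  simp only [← mulVec_mulVec, h₃, mulVec_smul, pow_mulVec_of_eq_smul h₂,
    pow_mulVec_of_eq_smul h₅] at key
  simp only [dotProduct_smul, dotProduct_mulVec f, vecMul_pow_of_eq_smul h₁, h₄, smul_dotProduct,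
    smul_eq_mul] at key
  obtain ⟨m, rfl⟩ := Nat.exists_eq_add_of_le' hk
  rw [show 2 * (m + 2) - 1 = 2 * m + 3 by omega, show (9 : ℤ) = 3 ^ 2 by norm_num, ← pow_mul,
    show (27 : ℤ) = 3 ^ 3 by norm_num, ← pow_add] at key
  have hpos : (0 : ℤ) < 3 ^ (2 * (2 * m + 3) + 3) := by positivity
  have hkey : (3 : ℤ) ^ (2 * (2 * m + 3) + 3) * (3 * (f ᵥ* Q ⬝ᵥ e)) =
      3 ^ (2 * (2 * m + 3) + 3) * 1 := by
    rw [mul_one]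
    refine .trans ?_ key
    ring
  have := mul_left_cancel₀ hpos.ne' hkey
  omega

/-- `T_k` is positive, `Δ` is not a prefix of `T_k`, `T_k ≼ Δ^{4k-1}`,
`¬(T_k ≼ Δ^{4k-2})`; consequently `inf T_k = 0`, `sup T_k = 4k-1` and the canonical
length of `T_k` is `4k-1`. -/
theorem Tk_inf_sup_len (k : ℕ) (hk : 2 ≤ k) :
    IsPos (T k) ∧ ¬ Pre Δ (T k) ∧ Pre (T k) (Δ ^ (4*k-1)) ∧ ¬ Pre (T k) (Δ ^ (4*k-2)) ∧
    IsGreatest { p : ℤ | Pre (Δ ^ p) (T k) } 0 ∧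
    IsLeast { q : ℤ | Pre (T k) (Δ ^ q) } (4*(k:ℤ) - 1) ∧
    canLen (T k) = 4*k - 1 := by
  have hpos := isPos_T k
  have hinf := not_pre_Δ_T k
  have hle := pre_T_Δ_pow hk
  have hlt := not_pre_T_Δ_pow hk
  have hp : ∀ p : ℤ, Pre (Δ ^ p) (T k) → p ≤ 0 := by
    intro p h
    by_contra! h0
    have h1 := (Pre.pow_of_isPos isPos_Δ (show 1 ≤ p from h0)).trans h
    rw [zpow_one] at h1
    exact hinf h1
  have hq : ∀ q : ℤ, Pre (T k) (Δ ^ q) → 4 * (k : ℤ) - 1 ≤ q := by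
    intro q h
    by_contra! h0
    have h1 := h.trans (Pre.pow_of_isPos isPos_Δ (show q ≤ ((4 * k - 2 : ℕ) : ℤ) by omega))
    rw [zpow_natCast] at h1
    exact hlt h1
  have hzero : Pre (Δ ^ (0 : ℤ)) (T k) := by simpa [Pre] using hpos
  have htop : Pre (T k) (Δ ^ (4 * (k : ℤ) - 1)) := by
    rw [show 4 * (k : ℤ) - 1 = ((4 * k - 1 : ℕ) : ℤ) by omega, zpow_natCast]
    exact hle
  have hmem : 4 * k - 1 ∈ { n : ℕ | ∃ p q : ℤ, p ≤ q ∧ q - p = (n : ℤ) ∧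
      Pre (Δ ^ p) (T k) ∧ Pre (T k) (Δ ^ q) } :=
    ⟨0, 4 * (k : ℤ) - 1, by omega, by omega, hzero, htop⟩
  refine ⟨hpos, hinf, hle, hlt, ⟨hzero, hp⟩, ⟨htop, hq⟩,
    le_antisymm (Nat.sInf_le hmem) (le_csInf ⟨_, hmem⟩ ?_)⟩
  rintro n ⟨p, q, -, hn, h₁, h₂⟩
  have := hp p h₁
  have := hq q h₂
  omega
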